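/- For every complex q with |q| < 1: ∑_{n≥0} q^{2n+1}/(1 − q^{5n+4}) − ∑_{n≥0} q^{3n}/(1 − q^{5n+1}) = −(q^5, q^5; q^5)_∞ / (q^2, q^3; q^5)_∞. -/

import Mathlib

/-!
Common definitions: for a partition `π` of `n`,
`numParts` is the number of parts, `largestPart` the largest part,
`omegaOnes` the number of parts equal to 1, `rank` and `crank` the
Dyson rank and Andrews–Garvan crank.  `NT m j n` is the total number of
parts over partitions of `n` with rank ≡ m (mod j), and `Mw m j n` is
the total number of ones over partitions of `n` with crank ≡ m (mod j).
`poch a q = (a; q)_∞ = ∏_{n ≥ 0} (1 - a qⁿ)`.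
-/

namespace Beck

/-- number of parts of a partition -/
def numParts {n : ℕ} (π : n.Partition) : ℕ := Multiset.card π.parts

/-- largest part of a partition (0 for the empty partition) -/
def largestPart {n : ℕ} (π : n.Partition) : ℕ := π.parts.sup

/-- number of ones in a partition -/
def omegaOnes {n : ℕ} (π : n.Partition) : ℕ := π.parts.count 1

/-- number of parts strictly larger than the number of ones -/
def muParts {n : ℕ} (π : n.Partition) : ℕ :=
  Multiset.card (π.parts.filter fun x => omegaOnes π < x)

/-- Dyson's rank: largest part minus number of parts -/
def rank {n : ℕ} (π : n.Partition) : ℤ :=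
  (largestPart π : ℤ) - (numParts π : ℤ)

/-- the Andrews–Garvan crank -/
def crank {n : ℕ} (π : n.Partition) : ℤ :=
  if omegaOnes π = 0 then (largestPart π : ℤ)
  else (muParts π : ℤ) - (omegaOnes π : ℤ)

/-- `NT m j n`: total number of parts in partitions of `n` with rank ≡ m (mod j) -/
def NT (m j n : ℕ) : ℤ :=
  ∑ π : n.Partition,
    if rank π % (j : ℤ) = (m : ℤ) % (j : ℤ) then (numParts π : ℤ) else 0

/-- `Mw m j n`: total number of ones in partitions of `n` with crank ≡ m (mod j) -/
def Mw (m j n : ℕ) : ℤ :=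
  ∑ π : n.Partition,
    if crank π % (j : ℤ) = (m : ℤ) % (j : ℤ) then (omegaOnes π : ℤ) else 0

/-- `(a; q)_∞ = ∏_{n ≥ 0} (1 - a qⁿ)` -/
noncomputable def poch (a q : ℂ) : ℂ := ∏' n : ℕ, (1 - a * q ^ n)

open Filter Topology

/-- `(a; Q)_n = ∏_{j < n} (1 - a Q^j)` -/
noncomputable def finPoch (a Q : ℂ) (n : ℕ) : ℂ := ∏ j ∈ Finset.range n, (1 - a * Q ^ j)

@[simp] lemma finPoch_zero (a Q : ℂ) : finPoch a Q 0 = 1 := by simp [finPoch]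

lemma finPoch_succ (a Q : ℂ) (n : ℕ) :
    finPoch a Q (n + 1) = finPoch a Q n * (1 - a * Q ^ n) := by
  simp [finPoch, Finset.prod_range_succ]

lemma finPoch_add (a Q : ℂ) (m n : ℕ) :
    finPoch a Q (m + n) = finPoch a Q m * finPoch (a * Q ^ m) Q n := by
  simp only [finPoch, Finset.prod_range_add, pow_add, mul_assoc]

lemma finPoch_ne_zero {a Q : ℂ} {n : ℕ} (h : ∀ j < n, a * Q ^ j ≠ 1) : finPoch a Q n ≠ 0 := by
  refine Finset.prod_ne_zero_iff.2 fun j hj => sub_ne_zero.2 fun hj' => ?_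
  exact h j (Finset.mem_range.1 hj) hj'.symm

/-- Reflection of a finite `q`-Pochhammer symbol. -/
lemma finPoch_div_pow {z Q : ℂ} (hz : z ≠ 0) (hQ : Q ≠ 0) (n : ℕ) :
    finPoch (z / Q ^ n) Q n
      = z ^ n * (∏ j ∈ Finset.range n, (-(1 / Q ^ (j + 1)))) * finPoch (Q / z) Q n := by
  have hpow : z ^ n = ∏ _j ∈ Finset.range n, z := by simp
  rw [finPoch, finPoch, ← Finset.prod_range_reflect, hpow, ← Finset.prod_mul_distrib,
    ← Finset.prod_mul_distrib]
  refine Finset.prod_congr rfl fun j hj => ?_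
  obtain ⟨k, rfl⟩ := Nat.exists_eq_add_of_lt (Finset.mem_range.1 hj)
  rw [show j + k + 1 - 1 - j = k by omega]
  field_simp
  ring

/-- Partial fraction expansion of `(Az; Q)_M / (A; Q)_{M+1}` in `A`. -/
lemma finPoch_partial_fraction {z Q : ℂ} (hz : z ≠ 0) (hQ : Q ≠ 0)
    (hQ1 : ∀ n : ℕ, Q ^ (n + 1) ≠ 1) (M : ℕ) (A : ℂ) (hA : ∀ i ≤ M, A * Q ^ i ≠ 1) :
    finPoch (A * z) Q M / finPoch A Q (M + 1)
      = ∑ i ∈ Finset.range (M + 1),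
          z ^ i * (finPoch (Q / z) Q i / finPoch Q Q i)
            * (finPoch z Q (M - i) / finPoch Q Q (M - i)) / (1 - A * Q ^ i) := by
  induction M generalizing A with
  | zero => simp [finPoch_succ]
  | succ M ih =>
    have hQQ : ∀ n, finPoch Q Q n ≠ 0 := fun n =>
      finPoch_ne_zero fun j _ => by rw [← pow_succ']; exact hQ1 j
    have hB : ∀ i ≤ M, 1 / Q ^ (M + 1) * Q ^ i ≠ 1 := by
      intro i hi h
      obtain ⟨k, rfl⟩ := Nat.exists_eq_add_of_le hi
      apply hQ1 k
      field_simp at h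
      rw [show i + k + 1 = i + (k + 1) by ring, pow_add] at h
      exact (mul_right_cancel₀ (pow_ne_zero i hQ) (by rw [one_mul, mul_comm]; exact h.symm))
    have hlast : z ^ (M + 1) * (finPoch (Q / z) Q (M + 1) / finPoch Q Q (M + 1))
        = (1 - z / Q) * (finPoch (1 / Q ^ (M + 1) * z) Q M
            / finPoch (1 / Q ^ (M + 1)) Q (M + 1)) := by
      have h1 := finPoch_div_pow hz hQ (M + 1)
      have h2 := finPoch_div_pow one_ne_zero hQ (M + 1)
      have h3 : finPoch (1 / Q ^ (M + 1)) Q (M + 1) ≠ 0 :=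
        finPoch_ne_zero fun j hj => hB j (Nat.lt_succ_iff.1 hj)
      rw [finPoch_succ, show z / Q ^ (M + 1) * Q ^ M = z / Q by
        field_simp; ring] at h1
      rw [one_pow, one_mul, div_one] at h2
      rw [show 1 / Q ^ (M + 1) * z = z / Q ^ (M + 1) by ring, ← mul_div_assoc, ← mul_div_assoc,
        div_eq_div_iff (hQQ _) h3, mul_comm (1 - z / Q), h1, h2]
      ring
    have hA' : 1 - A * Q ^ (M + 1) ≠ 0 := sub_ne_zero.2 (hA _ le_rfl).symm
    rw [finPoch_succ, finPoch_succ A, mul_div_mul_comm, ih A fun i hi => hA i (hi.trans M.le_succ),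
      Finset.sum_range_succ _ (M + 1), Nat.sub_self, finPoch_zero, finPoch_zero, div_one, mul_one, hlast,
      ih _ hB, Finset.sum_mul, Finset.mul_sum, Finset.sum_div, ← Finset.sum_add_distrib]
    refine Finset.sum_congr rfl fun i hi => ?_
    have hi' : i ≤ M := Nat.lt_succ_iff.1 (Finset.mem_range.1 hi)
    have hAi : 1 - A * Q ^ i ≠ 0 := sub_ne_zero.2 (hA i (hi'.trans M.le_succ)).symm
    have hBi : 1 - 1 / Q ^ (M + 1) * Q ^ i ≠ 0 := sub_ne_zero.2 (hB i hi').symm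
    obtain ⟨k, rfl⟩ := Nat.exists_eq_add_of_le hi'
    rw [show i + k + 1 - i = k + 1 by omega, show i + k - i = k by omega, finPoch_succ z,
      finPoch_succ Q Q k, mul_div_mul_comm (finPoch z Q k)]
    have hk : 1 - Q ^ (k + 1) ≠ 0 := sub_ne_zero.2 (hQ1 k).symm
    have h : (1 - z / Q) / (1 - 1 / Q ^ (i + k + 1) * Q ^ i)
        = - (Q ^ k * (Q - z)) / (1 - Q ^ (k + 1)) := by
      rw [div_eq_div_iff hBi hk]
      field_simp
      ring
    have key : (1 - A * z * Q ^ (i + k)) / (1 - A * Q ^ (i + k + 1)) / (1 - A * Q ^ i)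
        = (1 - z * Q ^ k) / (1 - Q ^ (k + 1)) / (1 - A * Q ^ i)
          + (1 - z / Q) / (1 - 1 / Q ^ (i + k + 1) * Q ^ i) / (1 - A * Q ^ (i + k + 1)) := by
      rw [h, div_div, div_div, div_div, div_add_div _ _ (mul_ne_zero hk hAi) (mul_ne_zero hk hA'),
        div_eq_div_iff (mul_ne_zero hA' hAi)
          (mul_ne_zero (mul_ne_zero hk hAi) (mul_ne_zero hk hA'))]
      ring
    rw [← pow_succ' Q k]
    linear_combination (z ^ i * (finPoch (Q / z) Q i / finPoch Q Q i)
      * (finPoch z Q k / finPoch Q Q k)) * key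

lemma bilateral_partial_sum {q : ℂ} (hq0 : q ≠ 0) (hq1 : ∀ n : ℕ, q ^ (n + 1) ≠ 1) (N : ℕ) :
    1 / (1 - q ^ (5 * N + 1))
      = ∑ n ∈ Finset.range (N + 1),
          finPoch (q ^ 2) (q ^ 5) (N + n) / finPoch (q ^ 5) (q ^ 5) (N + n)
            * (finPoch (q ^ 3) (q ^ 5) (N - n) / finPoch (q ^ 5) (q ^ 5) (N - n))
            * (q ^ (3 * n) / (1 - q ^ (5 * n + 1)))
        - ∑ n ∈ Finset.range N,
          finPoch (q ^ 2) (q ^ 5) (N - 1 - n) / finPoch (q ^ 5) (q ^ 5) (N - 1 - n)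
            * (finPoch (q ^ 3) (q ^ 5) (N + n + 1) / finPoch (q ^ 5) (q ^ 5) (N + n + 1))
            * (q ^ (2 * n + 1) / (1 - q ^ (5 * n + 4))) := by
  have hne : ∀ n, 1 - q ^ (n + 1) ≠ 0 := fun n => sub_ne_zero.2 (hq1 n).symm
  have hQ : q ^ 5 ≠ 0 := pow_ne_zero 5 hq0
  have hQ1 : ∀ n : ℕ, (q ^ 5) ^ (n + 1) ≠ 1 := fun n => by
    rw [← pow_mul]; exact hq1 (5 * n + 4)
  have hP : ∀ a n, finPoch (q ^ (a + 1)) (q ^ 5) n ≠ 0 := fun a n =>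
    finPoch_ne_zero fun j _ => by
      rw [← pow_mul, ← pow_add, show a + 1 + 5 * j = a + 5 * j + 1 by ring]; exact hq1 _
  have hpos : ∀ n, q / (q ^ 5) ^ N * (q ^ 5) ^ (N + n) = q ^ (5 * n + 1) := fun n => by
    rw [pow_add]; field_simp; ring
  have hneg : ∀ i n, i + n + 1 = N → q / (q ^ 5) ^ N * (q ^ 5) ^ i = (q ^ (5 * n + 4))⁻¹ := by
    rintro i n rfl
    field_simp
    ring
  have hA : ∀ i ≤ N + N, q / (q ^ 5) ^ N * (q ^ 5) ^ i ≠ 1 := by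
    intro i _
    rcases le_or_gt N i with h | h
    · obtain ⟨n, rfl⟩ := Nat.exists_eq_add_of_le h
      rw [hpos]; exact hq1 _
    · obtain ⟨n, hn⟩ := Nat.exists_eq_add_of_lt h
      rw [hneg i n hn.symm]
      exact inv_ne_one.2 (hq1 _)
  have key := finPoch_partial_fraction (pow_ne_zero 3 hq0) hQ hQ1 (N + N) _ hA
  have hlhs : finPoch (q / (q ^ 5) ^ N * q ^ 3) (q ^ 5) (N + N)
      / finPoch (q / (q ^ 5) ^ N) (q ^ 5) (N + N + 1) = q ^ (3 * N) * (1 / (1 - q ^ (5 * N + 1))) := by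
    have hc : (∏ j ∈ Finset.range N, (-(1 / (q ^ 5) ^ (j + 1)))) ≠ 0 :=
      Finset.prod_ne_zero_iff.2 fun j _ =>
        neg_ne_zero.2 (one_div_ne_zero (pow_ne_zero _ hQ))
    have h1 := finPoch_div_pow (pow_ne_zero 4 hq0) hQ N
    have h2 := finPoch_div_pow hq0 hQ N
    rw [show q ^ 5 / q ^ 4 = q by field_simp] at h1
    rw [show q ^ 5 / q = q ^ 4 by field_simp] at h2
    rw [show q / (q ^ 5) ^ N * q ^ 3 = q ^ 4 / (q ^ 5) ^ N by ring, add_assoc, finPoch_add,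
      finPoch_add (q / _), h1, h2, div_mul_cancel₀ _ (pow_ne_zero N hQ),
      div_mul_cancel₀ _ (pow_ne_zero N hQ), finPoch_succ, ← pow_mul q 5, ← pow_succ' q (5 * N)]
    have h3 := hP 0 N
    have h4 := hP 3 N
    have h5 := hne (5 * N)
    norm_num at h3 h4
    field_simp
    ring
  rw [hlhs, add_assoc, Finset.sum_range_add, ← Finset.sum_range_reflect,
    show q ^ 5 / q ^ 3 = q ^ 2 by field_simp] at key
  apply mul_left_cancel₀ (pow_ne_zero (3 * N) hq0)
  rw [key, mul_sub, Finset.mul_sum, Finset.mul_sum, add_comm, sub_eq_add_neg,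
    ← Finset.sum_neg_distrib]
  congr 1
  · refine Finset.sum_congr rfl fun n _ => ?_
    rw [hpos, show N + N - (N + n) = N - n by omega]
    ring
  · refine Finset.sum_congr rfl fun n hn => ?_
    obtain ⟨k, rfl⟩ := Nat.exists_eq_add_of_lt (Finset.mem_range.1 hn)
    rw [show n + k + 1 - 1 - n = k by omega, hneg k n (by omega),
      show n + k + 1 + (n + k + 1) - k = n + k + 1 + n + 1 by omega]
    have h : (q ^ 3) ^ k / (1 - (q ^ (5 * n + 4))⁻¹)
        = - (q ^ (3 * (n + k + 1)) * (q ^ (2 * n + 1) / (1 - q ^ (5 * n + 4)))) := by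
      have h1 : 1 - q ^ (5 * n + 4) ≠ 0 := hne _
      have h2 : 1 - (q ^ (5 * n + 4))⁻¹ ≠ 0 := sub_ne_zero.2 (inv_ne_one.2 (hq1 _)).symm
      rw [← mul_div_assoc, ← neg_div, div_eq_div_iff h2 h1]
      field_simp
      ring
    linear_combination (finPoch (q ^ 2) (q ^ 5) k / finPoch (q ^ 5) (q ^ 5) k
      * (finPoch (q ^ 3) (q ^ 5) (n + k + 1 + n + 1)
        / finPoch (q ^ 5) (q ^ 5) (n + k + 1 + n + 1))) * h

lemma summable_norm_mul_pow (a : ℂ) {Q : ℂ} (hQ : ‖Q‖ < 1) :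
    Summable fun n : ℕ => ‖-(a * Q ^ n)‖ := by
  simpa using (summable_geometric_of_lt_one (norm_nonneg Q) hQ).mul_left ‖a‖

lemma tendsto_finPoch (a : ℂ) {Q : ℂ} (hQ : ‖Q‖ < 1) :
    Tendsto (finPoch a Q) atTop (𝓝 (poch a Q)) := by
  have h := (multipliable_one_add_of_summable (summable_norm_mul_pow a hQ)).hasProd
  simp only [← sub_eq_add_neg] at h
  exact h.tendsto_prod_nat

lemma poch_ne_zero {a Q : ℂ} (hQ : ‖Q‖ < 1) (h : ∀ n : ℕ, a * Q ^ n ≠ 1) : poch a Q ≠ 0 := by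
  have := tprod_one_add_ne_zero_of_summable (f := fun n : ℕ => -(a * Q ^ n))
    (fun n => by rw [← sub_eq_add_neg]; exact sub_ne_zero.2 (h n).symm)
    (summable_norm_mul_pow a hQ)
  simpa only [← sub_eq_add_neg, poch] using this

lemma tendsto_sum_range_mul {u v w : ℕ → ℂ} {U V : ℂ} {m : ℕ → ℕ} {i j : ℕ → ℕ → ℕ}
    (hu : Tendsto u atTop (𝓝 U)) (hv : Tendsto v atTop (𝓝 V))
    (hw : Summable fun n => ‖w n‖) (hm : Tendsto m atTop atTop)
    (hi : ∀ n, Tendsto (i · n) atTop atTop) (hj : ∀ n, Tendsto (j · n) atTop atTop) :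
    Tendsto (fun N => ∑ n ∈ Finset.range (m N), u (i N n) * v (j N n) * w n) atTop
      (𝓝 (U * V * ∑' n, w n)) := by
  obtain ⟨C, hC⟩ := (Metric.isBounded_range_of_tendsto u hu).exists_norm_le
  obtain ⟨D, hD⟩ := (Metric.isBounded_range_of_tendsto v hv).exists_norm_le
  have hC' : ∀ n, ‖u n‖ ≤ C := fun n => hC _ (Set.mem_range_self n)
  have hD' : ∀ n, ‖v n‖ ≤ D := fun n => hD _ (Set.mem_range_self n)
  have hC0 : 0 ≤ C := (norm_nonneg _).trans (hC' 0)
  have hD0 : 0 ≤ D := (norm_nonneg _).trans (hD' 0)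
  have h := tendsto_tsum_of_dominated_convergence (𝓕 := atTop)
    (f := fun N n => if n < m N then u (i N n) * v (j N n) * w n else 0)
    (g := fun n => U * V * w n) (hw.mul_left (C * D)) (fun n => ?_)
    (Eventually.of_forall fun N n => ?_)
  · rw [tsum_mul_left] at h
    refine h.congr fun N => ?_
    rw [tsum_eq_sum (s := Finset.range (m N)) fun n hn => if_neg (by simpa using hn)]
    exact Finset.sum_congr rfl fun n hn => if_pos (Finset.mem_range.1 hn)
  · refine (((hu.comp (hi n)).mul (hv.comp (hj n))).mul_const (w n)).congr' ?_
    filter_upwards [hm.eventually_gt_atTop n] with N hN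
    simp [hN]
  · split_ifs
    · rw [norm_mul, norm_mul]
      gcongr
      exacts [hC' _, hD' _]
    · rw [norm_zero]
      positivity

lemma summable_norm_pow_div {q : ℂ} (hq : ‖q‖ < 1) (a b c : ℕ) :
    Summable fun n : ℕ => ‖q ^ ((a + 1) * n + b) / (1 - q ^ (5 * n + c + 1))‖ := by
  have hq' : 0 < 1 - ‖q‖ := sub_pos.2 hq
  refine Summable.of_nonneg_of_le (fun n => norm_nonneg _) (fun n => ?_)
    ((summable_geometric_of_lt_one (norm_nonneg q) hq).div_const (1 - ‖q‖))
  rw [norm_div, norm_pow]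
  refine div_le_div₀ (by positivity) ?_ hq' ?_
  · exact pow_le_pow_of_le_one (norm_nonneg q) hq.le (by nlinarith)
  · calc 1 - ‖q‖ ≤ 1 - ‖q ^ (5 * n + c + 1)‖ := by
          rw [norm_pow]
          gcongr
          exact pow_le_of_le_one (norm_nonneg q) hq.le (Nat.succ_ne_zero _)
      _ ≤ ‖1 - q ^ (5 * n + c + 1)‖ := by
          simpa using norm_sub_norm_le (1 : ℂ) (q ^ (5 * n + c + 1))

lemma pow_succ_ne_one_of_norm_lt_one {q : ℂ} (hq : ‖q‖ < 1) (n : ℕ) : q ^ (n + 1) ≠ 1 := by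
  intro h
  have := pow_lt_one₀ (norm_nonneg q) hq n.succ_ne_zero
  rw [← norm_pow, h, norm_one] at this
  exact this.false

/-- The case `z = q³`, `a = q`, base `q⁵` of Kronecker's bilateral sum
`∑_{n ∈ ℤ} zⁿ / (1 - a Qⁿ)`. -/
lemma poch_mul_bilateral_sum {q : ℂ} (hq0 : q ≠ 0) (hq : ‖q‖ < 1) :
    poch (q ^ 2) (q ^ 5) / poch (q ^ 5) (q ^ 5) * (poch (q ^ 3) (q ^ 5) / poch (q ^ 5) (q ^ 5))
      * ((∑' n : ℕ, q ^ (3 * n) / (1 - q ^ (5 * n + 1)))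
        - ∑' n : ℕ, q ^ (2 * n + 1) / (1 - q ^ (5 * n + 4))) = 1 := by
  have hq1 := pow_succ_ne_one_of_norm_lt_one hq
  have hQ : ‖q ^ 5‖ < 1 := by
    rw [norm_pow]; exact pow_lt_one₀ (norm_nonneg q) hq (by norm_num)
  have hP : poch (q ^ 5) (q ^ 5) ≠ 0 := poch_ne_zero hQ fun n => by
    rw [← pow_succ', ← pow_mul]; exact hq1 (5 * n + 4)
  have hu := (tendsto_finPoch (q ^ 2) hQ).div (tendsto_finPoch (q ^ 5) hQ) hP
  have hv := (tendsto_finPoch (q ^ 3) hQ).div (tendsto_finPoch (q ^ 5) hQ) hP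
  have hpos := tendsto_sum_range_mul (m := fun N => N + 1) (i := fun N n => N + n)
    (j := fun N n => N - n) hu hv (summable_norm_pow_div hq 2 0 0) (tendsto_add_atTop_nat 1)
    (fun n => tendsto_add_atTop_nat n) (fun n => tendsto_sub_atTop_nat n)
  have hneg := tendsto_sum_range_mul (m := fun N => N) (i := fun N n => N - 1 - n)
    (j := fun N n => N + n + 1) hu hv (summable_norm_pow_div hq 1 1 3) tendsto_id
    (fun n => (tendsto_sub_atTop_nat n).comp (tendsto_sub_atTop_nat 1))
    (fun n => tendsto_add_atTop_nat (n + 1))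
  have hone : Tendsto (fun N : ℕ => 1 / (1 - q ^ (5 * N + 1))) atTop (𝓝 1) := by
    have h := (tendsto_pow_atTop_nhds_zero_of_norm_lt_one hq).comp
      (tendsto_atTop_mono (fun N : ℕ => (by omega : N ≤ 5 * N + 1)) tendsto_id)
    simpa [Function.comp_def] using (tendsto_const_nhds.sub h).inv₀ (by simp : (1 : ℂ) - 0 ≠ 0)
  rw [mul_sub]
  refine tendsto_nhds_unique (hpos.sub hneg) (hone.congr fun N => ?_)
  exact bilateral_partial_sum hq0 hq1 N

/-- Identity (2.8):
`∑_{n≥0} q^{2n+1}/(1 − q^{5n+4}) − ∑_{n≥0} q^{3n}/(1 − q^{5n+1})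
  = −(q⁵, q⁵; q⁵)_∞ / (q², q³; q⁵)_∞` for `|q| < 1`. -/
theorem statement_11 (q : ℂ) (hq : ‖q‖ < 1) :
    (∑' n : ℕ, q ^ (2 * n + 1) / (1 - q ^ (5 * n + 4)))
      - ∑' n : ℕ, q ^ (3 * n) / (1 - q ^ (5 * n + 1))
    = -((poch (q ^ 5) (q ^ 5) * poch (q ^ 5) (q ^ 5))
      / (poch (q ^ 2) (q ^ 5) * poch (q ^ 3) (q ^ 5))) := by
  rcases eq_or_ne q 0 with rfl | hq0
  · have h2 : (∑' n : ℕ, (0 : ℂ) ^ (3 * n) / (1 - 0 ^ (5 * n + 1))) = 1 := by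
      rw [tsum_eq_single 0 fun n hn => by simp [hn]]
      simp
    rw [h2]
    simp [poch]
  have h := poch_mul_bilateral_sum hq0 hq
  have h5 : poch (q ^ 5) (q ^ 5) ≠ 0 := fun h0 => by simp [h0] at h
  have h2 : poch (q ^ 2) (q ^ 5) ≠ 0 := fun h0 => by simp [h0] at h
  have h3 : poch (q ^ 3) (q ^ 5) ≠ 0 := fun h0 => by simp [h0] at h
  rw [eq_neg_iff_add_eq_zero, ← neg_eq_zero, neg_add, neg_sub, ← sub_eq_add_neg, sub_eq_zero,
    eq_div_iff (mul_ne_zero h2 h3)]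
  rw [← mul_div_mul_comm, div_mul_eq_mul_div, div_eq_one_iff_eq (mul_ne_zero h5 h5)] at h
  rw [← h, mul_comm]

end Beck
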